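/- arXiv:1308.2420 — 3 statements merged into one kernel-verified Lean document; each statement's English description precedes it below -/
import Mathlib

section
/- For every integer n ≥ 2, the Zariski closure in Mat_n(k) of the set {g x g^{-1} : g ∈ GL_n(k), x ∈ u_P} has dimension 2·⌊n²/4⌋. -/
open MvPolynomial Matrix TopologicalSpace

/-- The Zariski topology on `r`-tuples of `n × n` matrices over `k`, identified with
affine space `k^(r·n²)`: the topology generated by complements of hypersurfaces
(its closed sets are exactly the common zero loci of families of polynomials in the
matrix entries). -/
noncomputable def matTupleZariski (k : Type*) [CommRing k] (n r : ℕ) :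
    TopologicalSpace (Fin r → Matrix (Fin n) (Fin n) k) :=
  TopologicalSpace.generateFrom
    {U | ∃ p : MvPolynomial (Fin r × Fin n × Fin n) k,
      U = {x | MvPolynomial.eval (fun q => x q.1 q.2.1 q.2.2) p ≠ 0}}

/-- The Zariski topology on `n × n` matrices over `k`, identified with affine space `k^(n²)`. -/
noncomputable def matZariski (k : Type*) [CommRing k] (n : ℕ) :
    TopologicalSpace (Matrix (Fin n) (Fin n) k) :=
  TopologicalSpace.generateFrom
    {U | ∃ p : MvPolynomial (Fin n × Fin n) k,
      U = {x | MvPolynomial.eval (fun q => x q.1 q.2) p ≠ 0}}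

/-- `u_P`: the strictly lower-left block matrices for the partition `(⌈n/2⌉, ⌊n/2⌋)`:
matrices whose `(i, j)` entry vanishes unless `i ≥ ⌈n/2⌉` and `j < ⌈n/2⌉`
(`0`-indexed). It is a commutative subalgebra of nilpotent matrices of dimension
`⌊n²/4⌋`. -/
def uP (k : Type*) [Field k] (n : ℕ) : Set (Matrix (Fin n) (Fin n) k) :=
  {x | ∀ i j : Fin n, ((i : ℕ) < (n + 1) / 2 ∨ (n + 1) / 2 ≤ (j : ℕ)) → x i j = 0}


section KrullDimension

theorem Algebra.IsIntegral.ringKrullDim_eq_of_injective (R S : Type*) [CommRing R] [CommRing S]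
    [Algebra R S] [Algebra.IsIntegral R S] (h : Function.Injective (algebraMap R S)) :
    ringKrullDim S = ringKrullDim R := by
  refine le_antisymm ?_ ?_
  · refine Order.krullDim_le_of_strictMono (PrimeSpectrum.comap (algebraMap R S)) fun p q hpq => ?_
    exact Ideal.IsIntegral.comap_lt_comap (R := R) (show p.asIdeal < q.asIdeal from hpq)
  · have : FaithfulSMul R S := (faithfulSMul_iff_algebraMap_injective R S).2 h
    refine iSup_le fun l => ?_
    obtain ⟨⟨Q, hQ, hlies⟩⟩ := Ideal.nonempty_primesOver (S := S) l.head.asIdeal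
    obtain ⟨L, hL, -, -⟩ := Ideal.exists_ltSeries_of_hasGoingUp l Q
    rw [← hL]
    exact le_iSup (fun l : LTSeries (PrimeSpectrum S) => (l.length : WithBot ℕ∞)) L

theorem ringKrullDim_eq_of_trdeg_eq {k R : Type*} [Field k] [CommRing R] [IsDomain R]
    [Algebra k R] [Algebra.FiniteType k R] {d : ℕ} (h : Algebra.trdeg k R = d) :
    ringKrullDim R = d := by
  obtain ⟨s, g, hg, hint⟩ := exists_integral_inj_algHom_of_fg k R
  algebraize [g.toRingHom]
  have : IsScalarTower k (MvPolynomial (Fin s) k) R := .of_algHom g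
  have : Algebra.IsIntegral (MvPolynomial (Fin s) k) R := ⟨hint⟩
  have hinj : Function.Injective (algebraMap (MvPolynomial (Fin s) k) R) := hg
  have : FaithfulSMul (MvPolynomial (Fin s) k) R :=
    (faithfulSMul_iff_algebraMap_injective _ _).2 hinj
  have htr := lift_trdeg_add_eq k (MvPolynomial (Fin s) k) R
  rw [trdeg_eq_zero (R := MvPolynomial (Fin s) k), h] at htr
  have hs : s = d := by simpa using htr
  rw [Algebra.IsIntegral.ringKrullDim_eq_of_injective (MvPolynomial (Fin s) k) R hinj]
  simp [hs]

end KrullDimension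

section Zariski

variable {k : Type*} [Field k] {n : ℕ}

/-- The coordinates of a matrix, as a point of affine space. -/
def matCoords {k m : Type*} (x : Matrix m m k) : m × m → k := fun q => x q.1 q.2

theorem isInducing_pointToPoint_matCoords :
    @Topology.IsInducing _ _ (matZariski k n) _
      (fun x : Matrix (Fin n) (Fin n) k => pointToPoint (k := k) (matCoords x)) := by
  let := matZariski k n
  refine ⟨?_⟩
  rw [PrimeSpectrum.isTopologicalBasis_basic_opens.eq_generateFrom, induced_generateFrom_eq]
  change TopologicalSpace.generateFrom _ = _
  congr 1
  ext U
  simp only [Set.mem_ofPred_eq, Set.mem_image, Set.exists_range_iff]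
  refine exists_congr fun p => ?_
  rw [eq_comm]
  refine Eq.congr_left ?_
  ext x
  simp [pointToPoint, aeval_eq_eval]
  rfl

variable [IsAlgClosed k]

theorem topologicalKrullDim_closure_matZariski (T : Set (Matrix (Fin n) (Fin n) k)) :
    letI := matZariski k n
    topologicalKrullDim (closure T) =
      ringKrullDim (MvPolynomial (Fin n × Fin n) k ⧸ vanishingIdeal k (matCoords '' T)) := by
  let := matZariski k n
  set I := vanishingIdeal k (matCoords '' T)
  set pt := fun x : Matrix (Fin n) (Fin n) k => pointToPoint (k := k) (matCoords x) with hpt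
  have hind : Topology.IsInducing pt := isInducing_pointToPoint_matCoords
  have hcl : ∀ x, x ∈ closure T ↔ pt x ∈ PrimeSpectrum.zeroLocus (I : Set _) := by
    intro x
    rw [hind.closure_eq_preimage_closure_image, ← PrimeSpectrum.zeroLocus_vanishingIdeal_eq_closure,
      hpt, ← Set.image_image (pointToPoint (k := k)) matCoords, vanishingIdeal_pointToPoint]
    rfl
  rw [ringKrullDim_quotient]
  refine le_antisymm ?_ ?_
  · let f : closure T → PrimeSpectrum.zeroLocus (I : Set (MvPolynomial (Fin n × Fin n) k)) :=
      fun x => ⟨pt x, (hcl x).1 x.2⟩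
    have hf : Topology.IsInducing f :=
      .of_comp (hind.continuous.comp continuous_subtype_val |>.subtype_mk _)
        continuous_subtype_val (hind.comp .subtypeVal)
    refine hf.topologicalKrullDim_le.trans_eq ?_
    rw [topologicalKrullDim, ← Order.krullDim_orderDual]
    exact (Order.krullDim_eq_of_orderIso (PrimeSpectrum.zeroLocusEquivIrreducibleCloseds _)).symm
  · have key : ∀ P : PrimeSpectrum (MvPolynomial (Fin n × Fin n) k), I ≤ P.asIdeal →
        ∀ g ∉ P.asIdeal, ∃ x ∈ closure T, P ≤ pt x ∧ g ∉ (pt x).asIdeal := by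
      intro P hP g hg
      rw [← IsPrime.vanishingIdeal_zeroLocus (K := k) P.asIdeal] at hg
      simp only [mem_vanishingIdeal_iff, not_forall] at hg
      obtain ⟨v, hv, hgv⟩ := hg
      have hle : P ≤ pt (fun i j => v (i, j)) := fun p hp => by
        rintro _ rfl
        exact hv p hp
      exact ⟨fun i j => v (i, j), (hcl _).2 (hP.trans hle), hle, fun h => hgv (h _ rfl)⟩
    let W (P : PrimeSpectrum.zeroLocus (I : Set (MvPolynomial (Fin n × Fin n) k))) :
        IrreducibleCloseds (closure T) :=
      { carrier := {x | P.1 ≤ pt x}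
        isClosed' := by
          have : IsClosed {q | P.1 ≤ q} :=
            PrimeSpectrum.isClosed_zeroLocus (P.1.asIdeal : Set (MvPolynomial (Fin n × Fin n) k))
          exact this.preimage (hind.continuous.comp continuous_subtype_val)
        isIrreducible' := by
          have hPI : I ≤ P.1.asIdeal := P.2
          constructor
          · obtain ⟨x, hx, hPx, -⟩ :=
              key P.1 hPI 1 (P.1.asIdeal.ne_top_iff_one.1 P.1.isPrime.ne_top)
            exact ⟨⟨x, hx⟩, hPx⟩
          · intro U V hU hV hWU hWV
            have hind' := hind.comp (Topology.IsInducing.subtypeVal (t := closure T))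
            obtain ⟨U', hU', rfl⟩ := hind'.isOpen_iff.1 hU
            obtain ⟨V', hV', rfl⟩ := hind'.isOpen_iff.1 hV
            obtain ⟨u, hu, huU⟩ := hWU
            obtain ⟨v, hv, hvV⟩ := hWV
            have h1 : P.1 ∈ U' :=
              ((PrimeSpectrum.le_iff_specializes _ _).1 hu).mem_open hU' huU
            have h2 : P.1 ∈ V' :=
              ((PrimeSpectrum.le_iff_specializes _ _).1 hv).mem_open hV' hvV
            obtain ⟨_, ⟨g, rfl⟩, hg, hgs⟩ :=
              PrimeSpectrum.isTopologicalBasis_basic_opens.exists_subset_of_mem_open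
                (show P.1 ∈ U' ∩ V' from ⟨h1, h2⟩) (hU'.inter hV')
            obtain ⟨x, hx, hPx, hgx⟩ := key P.1 hPI g hg
            exact ⟨⟨x, hx⟩, hPx, hgs hgx⟩ }
    rw [← Order.krullDim_orderDual]
    refine Order.krullDim_le_of_strictMono (fun P => W (OrderDual.ofDual P)) ?_
    intro P Q hPQ
    change W (OrderDual.ofDual P) < W (OrderDual.ofDual Q)
    generalize hP' : OrderDual.ofDual P = P'
    generalize hQ' : OrderDual.ofDual Q = Q'
    have hlt : Q'.1 < P'.1 := by rw [← hP', ← hQ']; exact hPQ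
    have hle : W P' ≤ W Q' := fun x (hx : P'.1 ≤ pt x) => hlt.le.trans hx
    refine lt_of_le_not_ge hle fun hge => ?_
    obtain ⟨g, hg, hgQ⟩ := SetLike.exists_of_lt (show Q'.1.asIdeal < P'.1.asIdeal from hlt)
    obtain ⟨x, hx, hQx, hgx⟩ := key Q'.1 Q'.2 g hgQ
    have : P'.1 ≤ pt x := hge (show (⟨x, hx⟩ : closure T) ∈ W Q' from hQx)
    exact hgx (this hg)

end Zariski

theorem MvPolynomial.eval_aeval {k σ τ : Type*} [CommRing k] (v : τ → k)
    (w : σ → MvPolynomial τ k) (F : MvPolynomial σ k) :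
    eval v (aeval w F) = eval (fun i => eval v (w i)) F := by
  induction F using MvPolynomial.induction_on <;> simp_all

section SquareZeroChart

variable {P Q : Type*} [Fintype P] [Fintype Q] [DecidableEq P] [DecidableEq Q]

/-- The conjugate of the strictly lower-left block matrix with block `B` by the unipotent upper
block matrix with block `A`. -/
def squareZeroChart {R : Type*} [CommRing R] (A : Matrix P Q R) (B : Matrix Q P R) :
    Matrix (P ⊕ Q) (P ⊕ Q) R :=
  fromBlocks (A * B) (-(A * B * A)) B (-(B * A))

omit [DecidableEq P] [DecidableEq Q] in
theorem squareZeroChart_map {R S : Type*} [CommRing R] [CommRing S] (f : R →+* S)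
    (A : Matrix P Q R) (B : Matrix Q P R) :
    (squareZeroChart A B).map f = squareZeroChart (A.map f) (B.map f) := by
  ext (i | i) (j | j) <;> simp [squareZeroChart, Matrix.mul_apply]

theorem squareZeroChart_eq_conj {R : Type*} [CommRing R] (A : Matrix P Q R) (B : Matrix Q P R) :
    squareZeroChart A B =
      fromBlocks 1 A 0 1 * fromBlocks 0 0 B 0 * fromBlocks 1 (-A) 0 1 := by
  simp [squareZeroChart, fromBlocks_multiply, Matrix.mul_assoc]

omit [DecidableEq P] [DecidableEq Q] in
theorem squareZeroChart_mul {R : Type*} [CommRing R] (A : Matrix P Q R) (B : Matrix Q P R)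
    (a : Matrix P P R) (c : Matrix Q P R) (d : Matrix Q Q R) :
    squareZeroChart A B * fromBlocks (a + A * c) (A * d) c d =
      fromBlocks (A * (B * a)) 0 (B * a) 0 := by
  simp [squareZeroChart, fromBlocks_multiply, Matrix.mul_add, Matrix.mul_assoc]

variable {k : Type*} [Field k]

/-- The big cell: conjugates by matrices with invertible lower-right block lie in the chart. -/
theorem exists_squareZeroChart_eq (g : Matrix (P ⊕ Q) (P ⊕ Q) k) (hg : g.det ≠ 0)
    (hd : g.toBlocks₂₂.det ≠ 0) (B : Matrix Q P k) :
    ∃ A B', g * fromBlocks 0 0 B 0 * g.adjugate = squareZeroChart A B' := by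
  obtain ⟨a, b, c, d, rfl⟩ : ∃ a b c d, g = fromBlocks a b c d :=
    ⟨_, _, _, _, (fromBlocks_toBlocks g).symm⟩
  simp only [toBlocks_fromBlocks₂₂] at hd
  set D := (fromBlocks a b c d).det with hD
  have hdu : IsUnit d.det := hd.isUnit
  let := d.invertibleOfIsUnitDet hdu
  let s := a - b * d⁻¹ * c
  have hs : IsUnit s.det := by
    rw [hD, det_fromBlocks₂₂, invOf_eq_nonsing_inv] at hg
    exact (right_ne_zero_of_mul hg).isUnit
  refine ⟨b * d⁻¹, D • (d * B * s⁻¹), ?_⟩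
  have hgu : IsUnit (fromBlocks a b c d).det := hg.isUnit
  have hgU : IsUnit (fromBlocks a b c d) := (isUnit_iff_isUnit_det _).2 hgu
  refine hgU.mul_right_cancel ?_
  have h1 : fromBlocks a b c d = fromBlocks (s + b * d⁻¹ * c) (b * d⁻¹ * d) c d := by
    simp [s, Matrix.mul_assoc, nonsing_inv_mul d hdu]
  rw [Matrix.mul_assoc _ (adjugate _), adjugate_mul, ← hD]
  conv_rhs => rw [h1]
  rw [squareZeroChart_mul, smul_mul, Matrix.mul_assoc _ s⁻¹, nonsing_inv_mul s hs]
  simp [fromBlocks_multiply, Matrix.mul_assoc, ← Matrix.mul_assoc d⁻¹ d, nonsing_inv_mul d hdu,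
    fromBlocks_smul]

theorem eval_conj_eq_zero_of_eval_squareZeroChart [Infinite k]
    (F : MvPolynomial ((P ⊕ Q) × (P ⊕ Q)) k)
    (hF : ∀ A B, eval (matCoords (squareZeroChart A B)) F = 0)
    (g : (Matrix (P ⊕ Q) (P ⊕ Q) k)ˣ) (B : Matrix Q P k) :
    eval (matCoords (g.1 * fromBlocks 0 0 B 0 * g⁻¹.1)) F = 0 := by
  have hadj : ∀ (B₀ : Matrix Q P k) (h : Matrix (P ⊕ Q) (P ⊕ Q) k),
      eval (matCoords (h * fromBlocks 0 0 B₀ 0 * h.adjugate)) F = 0 := by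
    intro B₀
    let G : Matrix (P ⊕ Q) (P ⊕ Q) (MvPolynomial ((P ⊕ Q) × (P ⊕ Q)) k) := mvPolynomialX _ _ k
    let X₀ : Matrix (P ⊕ Q) (P ⊕ Q) k := fromBlocks 0 0 B₀ 0
    let p : MvPolynomial ((P ⊕ Q) × (P ⊕ Q)) k :=
      aeval (matCoords (G * X₀.map C * G.adjugate)) F
    have hG : ∀ v : (P ⊕ Q) × (P ⊕ Q) → k, G.map (eval v) = Matrix.of fun i j => v (i, j) := by
      intro v
      ext i j
      simp [G]
    have hp : ∀ v : (P ⊕ Q) × (P ⊕ Q) → k, eval v p =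
        eval (matCoords ((G.map (eval v)) * X₀ * (G.map (eval v)).adjugate)) F := by
      intro v
      have h1 : (G * X₀.map C * G.adjugate).map (eval v) =
          (G.map (eval v)) * X₀ * (G.map (eval v)).adjugate := by
        rw [Matrix.map_mul, Matrix.map_mul, ← RingHom.mapMatrix_apply _ G.adjugate,
          RingHom.map_adjugate, RingHom.mapMatrix_apply, Matrix.map_map]
        congr
        ext
        simp
      rw [← h1]
      exact eval_aeval _ _ _
    have hmul : p * (G.det * G.toBlocks₂₂.det) = 0 := by
      refine MvPolynomial.funext fun v => ?_
      rw [map_mul, map_mul, map_zero, hp, RingHom.map_det, RingHom.map_det,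
        RingHom.mapMatrix_apply, RingHom.mapMatrix_apply]
      by_cases h1 : (G.map (eval v)).det = 0
      · simp [h1]
      by_cases h2 : (G.toBlocks₂₂.map (eval v)).det = 0
      · simp [h2]
      obtain ⟨A, B', h⟩ := exists_squareZeroChart_eq _ h1 h2 B₀
      rw [h, hF, zero_mul]
    have h22 : G.toBlocks₂₂.det ≠ 0 := by
      intro h
      have := congr_arg (eval fun q => (1 : Matrix (P ⊕ Q) (P ⊕ Q) k) q.1 q.2) h
      rw [RingHom.map_det, RingHom.mapMatrix_apply, map_zero] at this
      refine one_ne_zero (α := k) ?_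
      rw [← this, ← det_one (n := Q)]
      congr 1
      ext i j
      simp [G, toBlocks₂₂, Matrix.one_apply]
    have hp0 : p = 0 := by
      refine (mul_eq_zero.1 hmul).resolve_right (mul_ne_zero ?_ h22)
      exact det_mvPolynomialX_ne_zero _ _
    intro h
    have := hp fun q => h q.1 q.2
    rw [hp0, map_zero, hG] at this
    exact this.symm
  have hdet : g.1.det ≠ 0 := ((isUnit_iff_isUnit_det _).1 g.isUnit).ne_zero
  have := hadj (g.1.det⁻¹ • B) g.1
  convert this using 3
  have h1 : g⁻¹.1 = g.1.det⁻¹ • g.1.adjugate := by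
    rw [coe_units_inv, inv_def, Ring.inverse_eq_inv']
  have h2 : (fromBlocks 0 0 (g.1.det⁻¹ • B) 0 : Matrix (P ⊕ Q) (P ⊕ Q) k) =
      g.1.det⁻¹ • fromBlocks 0 0 B 0 := by simp [fromBlocks_smul]
  rw [h1, h2]
  simp

variable (k) in
/-- The generic upper block `A`. -/
noncomputable def chartVarsUpper (P Q : Type*) :
    Matrix P Q (MvPolynomial ((P × Q) ⊕ (Q × P)) k) :=
  of fun i j => X (.inl (i, j))

variable (k) in
/-- The generic lower block `B`. -/
noncomputable def chartVarsLower (P Q : Type*) :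
    Matrix Q P (MvPolynomial ((P × Q) ⊕ (Q × P)) k) :=
  of fun i j => X (.inr (i, j))

variable (k P Q) in
/-- The comorphism of the chart `(A, B) ↦ squareZeroChart A B`. -/
noncomputable def squareZeroChartHom :
    MvPolynomial ((P ⊕ Q) × (P ⊕ Q)) k →ₐ[k] MvPolynomial ((P × Q) ⊕ (Q × P)) k :=
  aeval (matCoords (squareZeroChart (chartVarsUpper k P Q) (chartVarsLower k P Q)))

omit [DecidableEq P] [DecidableEq Q] in
theorem eval_squareZeroChartHom (v : (P × Q) ⊕ (Q × P) → k)
    (F : MvPolynomial ((P ⊕ Q) × (P ⊕ Q)) k) :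
    eval v (squareZeroChartHom P Q k F) =
      eval (matCoords (squareZeroChart (of fun i j => v (.inl (i, j)))
        (of fun i j => v (.inr (i, j))))) F := by
  have h : (squareZeroChart (chartVarsUpper k P Q) (chartVarsLower k P Q)).map (eval v) =
      squareZeroChart (of fun i j => v (.inl (i, j))) (of fun i j => v (.inr (i, j))) := by
    rw [squareZeroChart_map]
    congr 1 <;> ext <;> simp [chartVarsUpper, chartVarsLower]
  rw [← h]
  exact eval_aeval _ _ _

/-- The generic fibres of the chart are finite: the polynomial ring of the chart is algebraic
over the coordinate ring of the image. -/
theorem isAlgebraic_range_squareZeroChartHom (c : Q ↪ P) :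
    Algebra.IsAlgebraic (squareZeroChartHom P Q k).range
      (MvPolynomial ((P × Q) ⊕ (Q × P)) k) := by
  set S := (squareZeroChartHom P Q k).range
  let A := chartVarsUpper k P Q
  let B := chartVarsLower k P Q
  have hS : ∀ i j, squareZeroChart A B i j ∈ S := fun i j =>
    ⟨X (i, j), by simp [squareZeroChartHom, matCoords, A, B]⟩
  let M : Matrix P Q S := of fun i j =>
    ⟨(A * B) i (c j), by simpa [squareZeroChart] using hS (.inl i) (.inl (c j))⟩
  let N : Matrix Q Q S := of fun i j =>
    ⟨B i (c j), by simpa [squareZeroChart] using hS (.inr i) (.inl (c j))⟩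
  have hM : M.map S.val = A * N.map S.val := by
    ext i j
    simp [M, N, Matrix.mul_apply]
  have hA : (M * N.adjugate).map S.val = (N.map S.val).det • A := by
    rw [Matrix.map_mul, hM, Matrix.mul_assoc, ← AlgHom.mapMatrix_apply _ N.adjugate,
      AlgHom.map_adjugate, AlgHom.mapMatrix_apply, mul_adjugate]
    simp
  have hdet : N.det ≠ 0 := by
    intro h
    let v : (P × Q) ⊕ (Q × P) → k := Sum.elim 0 fun q => if c q.1 = q.2 then 1 else 0
    have h1 := congr_arg (fun s => eval v (S.val s)) h
    simp only [map_zero] at h1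
    rw [AlgHom.map_det, RingHom.map_det, AlgHom.mapMatrix_apply, RingHom.mapMatrix_apply] at h1
    refine one_ne_zero (α := k) ?_
    rw [← h1, ← det_one (n := Q)]
    congr 1
    ext i j
    simp [N, B, chartVarsLower, v, Matrix.one_apply]
  have hX : ∀ i, X i ∈ Subalgebra.algebraicClosure S (MvPolynomial ((P × Q) ⊕ (Q × P)) k) := by
    rintro (⟨i, j⟩ | ⟨i, j⟩)
    · refine IsAlgebraic.of_smul (y := N.det) (mem_nonZeroDivisors_of_ne_zero hdet) ?_
      convert isAlgebraic_algebraMap ((M * N.adjugate) i j) using 1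
      have := congr_fun₂ hA i j
      rw [← AlgHom.mapMatrix_apply, ← AlgHom.map_det] at this
      simpa [A, chartVarsUpper, Algebra.smul_def] using this.symm
    · exact isAlgebraic_algebraMap
        (⟨B i j, by simpa [squareZeroChart] using hS (.inr i) (.inl j)⟩ : S)
  refine ⟨fun p => ?_⟩
  have hp : p ∈ Algebra.adjoin k (Set.range (X : _ → MvPolynomial ((P × Q) ⊕ (Q × P)) k)) := by
    rw [adjoin_range_X]; trivial
  have hle : Algebra.adjoin k (Set.range (X : _ → MvPolynomial ((P × Q) ⊕ (Q × P)) k)) ≤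
      (Subalgebra.algebraicClosure S _).restrictScalars k :=
    Algebra.adjoin_le (by rintro _ ⟨i, rfl⟩; exact hX i)
  exact hle hp

theorem ringKrullDim_range_squareZeroChartHom (c : Q ↪ P) :
    ringKrullDim (squareZeroChartHom P Q k).range =
      (2 * (Fintype.card P * Fintype.card Q) : ℕ) := by
  set S := (squareZeroChartHom P Q k).range
  have : Algebra.FiniteType k S :=
    .of_surjective (squareZeroChartHom P Q k).rangeRestrict
      (squareZeroChartHom P Q k).rangeRestrict_surjective
  have := isAlgebraic_range_squareZeroChartHom (k := k) c
  refine ringKrullDim_eq_of_trdeg_eq (k := k) ?_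
  have htr := lift_trdeg_add_eq k S (MvPolynomial ((P × Q) ⊕ (Q × P)) k)
  rw [trdeg_eq_zero (R := S), MvPolynomial.trdeg_of_isDomain] at htr
  have h2 : 2 * (Fintype.card P * Fintype.card Q) = Fintype.card ((P × Q) ⊕ (Q × P)) := by
    simp [mul_comm (Fintype.card Q), two_mul]
  rw [h2]
  simpa using htr

/-- Polynomials vanishing on the conjugates of the strictly lower-left block matrices are those
vanishing on the chart. -/
theorem vanishingIdeal_conj_eq_ker [Infinite k] :
    vanishingIdeal k (matCoords '' {y : Matrix (P ⊕ Q) (P ⊕ Q) k |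
      ∃ g : (Matrix (P ⊕ Q) (P ⊕ Q) k)ˣ, ∃ B : Matrix Q P k,
        y = g.1 * fromBlocks 0 0 B 0 * g⁻¹.1}) = RingHom.ker (squareZeroChartHom P Q k) := by
  ext F
  rw [mem_vanishingIdeal_iff, Set.forall_mem_image, RingHom.mem_ker]
  constructor
  · intro h
    refine MvPolynomial.funext fun v => ?_
    rw [eval_squareZeroChartHom, map_zero, ← aeval_eq_eval]
    generalize (of fun i j => v (.inl (i, j)) : Matrix P Q k) = A
    generalize (of fun i j => v (.inr (i, j)) : Matrix Q P k) = B
    refine h ⟨⟨fromBlocks 1 A 0 1, fromBlocks 1 (-A) 0 1, ?_, ?_⟩, B,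
      squareZeroChart_eq_conj A B⟩ <;> simp [fromBlocks_multiply]
  · rintro h _ ⟨g, B, rfl⟩
    rw [aeval_eq_eval]
    refine eval_conj_eq_zero_of_eval_squareZeroChart F (fun A B => ?_) g B
    have := eval_squareZeroChartHom (Sum.elim (fun q => A q.1 q.2) fun q => B q.1 q.2) F
    rw [h, map_zero] at this
    exact this.symm

end SquareZeroChart

theorem mem_vanishingIdeal_reindex {k l m : Type*} [Field k] (e : l ≃ m)
    (T : Set (Matrix l l k)) (F : MvPolynomial (l × l) k) :
    rename (e.prodCongr e) F ∈ vanishingIdeal k (matCoords '' (reindex e e '' T)) ↔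
      F ∈ vanishingIdeal k (matCoords '' T) := by
  have h (x : Matrix l l k) : matCoords (reindex e e x) ∘ e.prodCongr e = matCoords x := by
    ext q
    simp [matCoords]
  simp only [mem_vanishingIdeal_iff, Set.forall_mem_image, aeval_rename, h]

theorem ringKrullDim_quotient_eq_of_ringEquiv {R S : Type*} [CommRing R] [CommRing S]
    (r : R ≃+* S) (I : Ideal R) (J : Ideal S) (h : ∀ x, r x ∈ J ↔ x ∈ I) :
    ringKrullDim (R ⧸ I) = ringKrullDim (S ⧸ J) := by
  refine ringKrullDim_eq_of_ringEquiv (Ideal.quotientEquiv I J r ?_)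
  ext y
  obtain ⟨x, rfl⟩ := r.surjective y
  rw [h]
  refine ⟨Ideal.mem_map_of_mem (r : R →+* S), fun hx => ?_⟩
  obtain ⟨z, hz, hzx⟩ := (Ideal.mem_map_iff_of_surjective (r : R →+* S) r.surjective).1 hx
  rwa [← r.injective hzx]

theorem ringKrullDim_quotient_vanishingIdeal_reindex {k l m : Type*} [Field k] (e : l ≃ m)
    (T : Set (Matrix l l k)) :
    ringKrullDim (MvPolynomial (m × m) k ⧸ vanishingIdeal k (matCoords '' (reindex e e '' T))) =
      ringKrullDim (MvPolynomial (l × l) k ⧸ vanishingIdeal k (matCoords '' T)) :=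
  (ringKrullDim_quotient_eq_of_ringEquiv (renameEquiv k (e.prodCongr e)).toRingEquiv _ _
    fun F => mem_vanishingIdeal_reindex e T F).symm

/-- For every integer `n ≥ 2`, the Zariski closure in `Mat_n(k)` of
`{g x g⁻¹ : g ∈ GL_n(k), x ∈ u_P}` has dimension `2·⌊n²/4⌋`. -/
theorem dim_closure_conjugates_uP (k : Type*) [Field k] [IsAlgClosed k]
    (n : ℕ) (hn : 2 ≤ n) :
    letI := matZariski k n
    topologicalKrullDim
        (closure {y : Matrix (Fin n) (Fin n) k | ∃ g : (Matrix (Fin n) (Fin n) k)ˣ,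
          ∃ x ∈ uP k n,
            y = (g : Matrix (Fin n) (Fin n) k) * x * (↑g⁻¹ : Matrix (Fin n) (Fin n) k)})
      = (2 * (n ^ 2 / 4) : ℕ) := by
  have hpq : (n + 1) / 2 + n / 2 = n := by omega
  let e : Fin ((n + 1) / 2) ⊕ Fin (n / 2) ≃ Fin n := finSumFinEquiv.trans (finCongr hpq)
  have : Infinite k := IsAlgClosed.instInfinite
  rw [topologicalKrullDim_closure_matZariski]
  have hT : {y : Matrix (Fin n) (Fin n) k | ∃ g : (Matrix (Fin n) (Fin n) k)ˣ, ∃ x ∈ uP k n,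
      y = g.1 * x * g⁻¹.1} = reindex e e '' {y | ∃ g : (Matrix _ _ k)ˣ, ∃ B : Matrix _ _ k,
        y = g.1 * fromBlocks 0 0 B 0 * g⁻¹.1} := by
    let r := reindexAlgEquiv k k e
    ext y
    constructor
    · rintro ⟨g, x, hx, rfl⟩
      refine ⟨r.symm (g.1 * x * g⁻¹.1), ⟨Units.map r.symm.toMonoidHom g,
        (r.symm x).toBlocks₂₁, ?_⟩, r.apply_symm_apply _⟩
      have h : fromBlocks 0 0 (r.symm x).toBlocks₂₁ 0 = r.symm x := by
        rw [← fromBlocks_toBlocks (r.symm x), toBlocks_fromBlocks₂₁]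
        congr 1 <;> ext i j <;> refine (hx _ _ ?_).symm <;> simp [e]
      rw [h, map_mul, map_mul]
      rfl
    · rintro ⟨_, ⟨g, B, rfl⟩, rfl⟩
      refine ⟨Units.map r.toMonoidHom g, r (fromBlocks 0 0 B 0), fun i j hij => ?_, ?_⟩
      · obtain ⟨i, rfl⟩ := e.surjective i
        obtain ⟨j, rfl⟩ := e.surjective j
        obtain i | i := i <;> obtain j | j := j <;> simp [r, e] at hij ⊢
        omega
      · change r _ = _
        rw [map_mul, map_mul]
        rfl
  rw [hT, ringKrullDim_quotient_vanishingIdeal_reindex, vanishingIdeal_conj_eq_ker,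
    ringKrullDim_eq_of_ringEquiv
      (Ideal.quotientKerEquivRange (squareZeroChartHom _ _ k)).toRingEquiv,
    ringKrullDim_range_squareZeroChartHom (Fin.castLEEmb (by omega))]
  have : (n + 1) / 2 * (n / 2) = n ^ 2 / 4 := by
    obtain ⟨m, rfl | rfl⟩ := n.even_or_odd'
    · rw [show (2 * m + 1) / 2 = m by omega, show 2 * m / 2 = m by omega,
        show (2 * m) ^ 2 = 4 * (m * m) by ring]
      omega
    · rw [show (2 * m + 1 + 1) / 2 = m + 1 by omega, show (2 * m + 1) / 2 = m by omega,
        show (2 * m + 1) ^ 2 = 4 * ((m + 1) * m) + 1 by ring]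
      omega
  simp [this]
end

section
/- For all integers n ≥ 2 and r ≥ 1, the set V_P is irreducible and dim V_P = (r+1)·⌊n²/4⌋; that is, dim V_P = (r+1)m² if n = 2m and dim V_P = (r+1)m(m+1) if n = 2m+1. -/
open MvPolynomial Matrix TopologicalSpace

/-- `V_P`: the Zariski closure of the set of simultaneous `GL_n(k)`-conjugates of
`r`-tuples from `u_P`. -/
noncomputable def VP (k : Type*) [Field k] (n r : ℕ) :
    Set (Fin r → Matrix (Fin n) (Fin n) k) :=
  letI := matTupleZariski k n r
  closure {y | ∃ g : (Matrix (Fin n) (Fin n) k)ˣ,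
    ∃ x : Fin r → Matrix (Fin n) (Fin n) k, (∀ i, x i ∈ uP k n) ∧
      y = fun i => (g : Matrix (Fin n) (Fin n) k) * x i * (↑g⁻¹ : Matrix (Fin n) (Fin n) k)}

open Order

/-- Krull dimension is invariant under injective integral extensions. -/
theorem ringKrullDim_eq_of_isIntegral (R S : Type*) [CommRing R] [CommRing S] [Algebra R S]
    [Algebra.IsIntegral R S] [FaithfulSMul R S] : ringKrullDim S = ringKrullDim R := by
  refine le_antisymm (krullDim_le_of_strictMono (PrimeSpectrum.comap (algebraMap R S))
    fun P Q h => Ideal.IsIntegral.comap_lt_comap h) (iSup_le fun l => ?_)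
  obtain ⟨⟨P, hP, hPl⟩⟩ := Ideal.nonempty_primesOver (S := S) l.head.asIdeal
  obtain ⟨M, hM, -⟩ := Ideal.exists_ltSeries_of_hasGoingUp l P
  rw [← hM]
  exact LTSeries.length_le_krullDim M

/-- The Krull dimension of an affine domain is its transcendence degree. -/
theorem ringKrullDim_eq_of_trdeg (k R : Type*) [Field k] [CommRing R] [IsDomain R]
    [Algebra k R] [Algebra.FiniteType k R] (N : ℕ) (h : Algebra.trdeg k R = N) :
    ringKrullDim R = N := by
  obtain ⟨s, g, hg, hgi⟩ := exists_integral_inj_algHom_of_fg k R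
  algebraize [g.toRingHom]
  have : FaithfulSMul (MvPolynomial (Fin s) k) R :=
    (faithfulSMul_iff_algebraMap_injective _ _).2 hg
  have : IsScalarTower k (MvPolynomial (Fin s) k) R := .of_algHom g
  have h1 := lift_trdeg_add_eq k (MvPolynomial (Fin s) k) R
  rw [ringKrullDim_eq_of_isIntegral (MvPolynomial (Fin s) k) R]
  have h2 : Algebra.trdeg (MvPolynomial (Fin s) k) R = 0 := trdeg_eq_zero
  simp [h, h2] at h1 ⊢
  exact_mod_cast h1

open Topology in
/-- If `Z` is irreducible and its intersection with the range of an inducing map is dense in it,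
then its preimage is irreducible. -/
theorem Topology.IsInducing.isIrreducible_preimage {X Y : Type*} [TopologicalSpace X]
    [TopologicalSpace Y] {f : Y → X} (hf : IsInducing f) {Z : Set X} (hZ : IsIrreducible Z)
    (hd : Z ⊆ closure (Z ∩ Set.range f)) : IsIrreducible (f ⁻¹' Z) := by
  have key : ∀ U : Set X, IsOpen U → (Z ∩ U).Nonempty → (f ⁻¹' Z ∩ f ⁻¹' U).Nonempty := by
    rintro U hU ⟨x, hxZ, hxU⟩
    obtain ⟨_, hyU, hyZ, y, rfl⟩ := mem_closure_iff.1 (hd hxZ) U hU hxU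
    exact ⟨y, hyZ, hyU⟩
  have rev : ∀ U : Set X, (f ⁻¹' Z ∩ f ⁻¹' U).Nonempty → (Z ∩ U).Nonempty :=
    fun U ⟨y, hy⟩ => ⟨f y, hy⟩
  refine ⟨by simpa using key Set.univ isOpen_univ (by simpa using hZ.1),
    fun u v hu hv hu' hv' => ?_⟩
  obtain ⟨U, hU, rfl⟩ := hf.isOpen_iff.1 hu
  obtain ⟨V, hV, rfl⟩ := hf.isOpen_iff.1 hv
  exact key _ (hU.inter hV) (hZ.2 U V hU hV (rev U hu') (rev V hv'))

open Topology TopologicalSpace in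
/-- An inducing map whose range is very dense preserves the topological Krull dimension. -/
theorem Topology.IsInducing.topologicalKrullDim_eq {X Y : Type*} [TopologicalSpace X]
    [TopologicalSpace Y] {f : Y → X} (hf : IsInducing f)
    (hd : ∀ Z : Set X, IsClosed Z → Z ⊆ closure (Z ∩ Set.range f)) :
    topologicalKrullDim Y = topologicalKrullDim X := by
  refine le_antisymm hf.topologicalKrullDim_le (krullDim_le_of_strictMono (fun Z =>
    (⟨f ⁻¹' Z, hf.isIrreducible_preimage Z.isIrreducible (hd _ Z.isClosed),
      Z.isClosed.preimage hf.continuous⟩ : IrreducibleCloseds Y)) ?_)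
  refine Monotone.strictMono_of_injective
    (fun A B h => Set.preimage_mono (f := f) (show (A : Set X) ⊆ (B : Set X) from h))
    fun A B h => ?_
  have h' : f ⁻¹' (A : Set X) = f ⁻¹' (B : Set X) := congrArg SetLike.coe h
  have h'' : (A : Set X) ∩ Set.range f = (B : Set X) ∩ Set.range f := by
    rw [← Set.image_preimage_eq_inter_range, h', Set.image_preimage_eq_inter_range]
  refine SetLike.coe_injective ((hd _ A.isClosed).trans ?_ |>.antisymm ((hd _ B.isClosed).trans ?_))
  · rw [h'']; exact closure_minimal Set.inter_subset_left B.isClosed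
  · rw [← h'']; exact closure_minimal Set.inter_subset_left A.isClosed

/-- In the spectrum of a Jacobson ring, every closed set is the closure of its intersection with any
set containing all closed points. -/
theorem PrimeSpectrum.subset_closure_of_closedPoints {R : Type*} [CommRing R] [IsJacobsonRing R]
    {S : Set (PrimeSpectrum R)} (hS : closedPoints _ ⊆ S) {Z : Set (PrimeSpectrum R)}
    (hZ : IsClosed Z) :
    Z ⊆ closure (Z ∩ S) := by
  conv_lhs => rw [← closure_inter_closedPoints hZ]
  exact closure_mono (Set.inter_subset_inter_right _ hS)

open Topology

/-- The Zariski topology on a set with coordinates `c` is induced from the prime spectrum of the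
polynomial ring. -/
theorem isInducing_pointToPoint {k σ X : Type*} [Field k] (c : X → σ → k) [t : TopologicalSpace X]
    (ht : t = generateFrom {U | ∃ p : MvPolynomial σ k, U = {x | eval (c x) p ≠ 0}}) :
    IsInducing (fun x => (pointToPoint (c x) : PrimeSpectrum (MvPolynomial σ k))) := by
  refine ⟨?_⟩
  rw [ht, PrimeSpectrum.isTopologicalBasis_basic_opens.eq_generateFrom, induced_generateFrom_eq]
  congr 1
  ext U
  constructor
  · rintro ⟨p, rfl⟩
    refine ⟨_, ⟨p, rfl⟩, ?_⟩
    ext x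
    simp [pointToPoint]
  · rintro ⟨_, ⟨p, rfl⟩, rfl⟩
    refine ⟨p, ?_⟩
    ext x
    simp [pointToPoint]

theorem pointToPoint_mem_zeroLocus {k σ : Type*} [Field k] {x : σ → k}
    {J : Ideal (MvPolynomial σ k)} :
    (pointToPoint x : PrimeSpectrum (MvPolynomial σ k)) ∈ PrimeSpectrum.zeroLocus J ↔
      x ∈ zeroLocus k J := by
  simp [pointToPoint, PrimeSpectrum.mem_zeroLocus, SetLike.le_def]

theorem closedPoints_subset_range_pointToPoint {k σ : Type*} [Field k] [IsAlgClosed k] [Finite σ] :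
    closedPoints (PrimeSpectrum (MvPolynomial σ k)) ⊆ Set.range (pointToPoint (k := k) (K := k)) := by
  intro P hP
  have := (PrimeSpectrum.isClosed_singleton_iff_isMaximal P).1 hP
  obtain ⟨x, hx⟩ := isMaximal_iff_eq_vanishingIdeal_singleton.1 this
  exact ⟨x, PrimeSpectrum.ext hx.symm⟩

/-- The zero locus of a prime ideal is irreducible. -/
theorem isIrreducible_preimage_zeroLocus {k σ X : Type*} [Field k] [IsAlgClosed k] [Finite σ]
    (c : X ≃ (σ → k)) [t : TopologicalSpace X]
    (ht : t = generateFrom {U | ∃ p : MvPolynomial σ k, U = {x | eval (c x) p ≠ 0}})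
    (J : Ideal (MvPolynomial σ k)) [hJ : J.IsPrime] :
    IsIrreducible (c ⁻¹' zeroLocus k J) := by
  have hf := isInducing_pointToPoint c ht
  have : c ⁻¹' zeroLocus k J =
      (fun x => (pointToPoint (c x) : PrimeSpectrum (MvPolynomial σ k))) ⁻¹'
        PrimeSpectrum.zeroLocus J := by
    ext x
    exact pointToPoint_mem_zeroLocus.symm
  rw [this]
  refine hf.isIrreducible_preimage ((PrimeSpectrum.isIrreducible_zeroLocus_iff_of_radical _
    hJ.isRadical).2 hJ) (PrimeSpectrum.subset_closure_of_closedPoints ?_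
      (PrimeSpectrum.isClosed_zeroLocus _))
  refine closedPoints_subset_range_pointToPoint.trans ?_
  rintro _ ⟨x, rfl⟩
  exact ⟨c.symm x, by simp⟩

/-- The dimension of the zero locus of an ideal is the Krull dimension of the quotient ring. -/
theorem topologicalKrullDim_preimage_zeroLocus {k σ X : Type*} [Field k] [IsAlgClosed k] [Finite σ]
    (c : X ≃ (σ → k)) [t : TopologicalSpace X]
    (ht : t = generateFrom {U | ∃ p : MvPolynomial σ k, U = {x | eval (c x) p ≠ 0}})
    (J : Ideal (MvPolynomial σ k)) :
    topologicalKrullDim (c ⁻¹' zeroLocus k J) = ringKrullDim (MvPolynomial σ k ⧸ J) := by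
  have hf := isInducing_pointToPoint c ht
  have hj := PrimeSpectrum.isClosedEmbedding_comap_of_surjective _ _
    (Ideal.Quotient.mk_surjective (I := J))
  have hrange : Set.range (PrimeSpectrum.comap (Ideal.Quotient.mk J)) =
      PrimeSpectrum.zeroLocus J := by
    rw [range_comap_of_surjective _ _ Ideal.Quotient.mk_surjective, Ideal.mk_ker]
  have hex : ∀ y : c ⁻¹' zeroLocus k J, ∃ P : PrimeSpectrum (MvPolynomial σ k ⧸ J),
      PrimeSpectrum.comap (Ideal.Quotient.mk J) P = pointToPoint (c y) := by
    intro y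
    rw [← Set.mem_range, hrange]
    exact pointToPoint_mem_zeroLocus.2 y.2
  choose f' hf' using hex
  have hind : IsInducing f' := by
    rw [← hj.isInducing.of_comp_iff]
    convert! hf.comp IsInducing.subtypeVal
    exact funext hf'
  rw [← PrimeSpectrum.topologicalKrullDim_eq_ringKrullDim]
  refine hind.topologicalKrullDim_eq fun Z hZ => PrimeSpectrum.subset_closure_of_closedPoints ?_ hZ
  intro M hM
  have h1 : PrimeSpectrum.comap (Ideal.Quotient.mk J) M ∈ closedPoints _ := by
    rwa [← Set.mem_preimage, hj.preimage_closedPoints]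
  obtain ⟨x, hx⟩ := closedPoints_subset_range_pointToPoint h1
  have hxJ : x ∈ zeroLocus k J := by
    rw [← pointToPoint_mem_zeroLocus, hx, ← hrange]
    exact ⟨M, rfl⟩
  refine ⟨⟨c.symm x, by simpa using hxJ⟩, hj.injective ?_⟩
  rw [hf', ← hx]
  simp

/-- The Zariski closure of a set is the zero locus of its vanishing ideal. -/
theorem closure_eq_preimage_zeroLocus {k σ X : Type*} [Field k]
    (c : X → (σ → k)) [t : TopologicalSpace X]
    (ht : t = generateFrom {U | ∃ p : MvPolynomial σ k, U = {x | eval (c x) p ≠ 0}})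
    (S : Set X) :
    closure S = c ⁻¹' zeroLocus k (vanishingIdeal k (c '' S)) := by
  rw [(isInducing_pointToPoint c ht).closure_eq_preimage_closure_image,
    ← PrimeSpectrum.zeroLocus_vanishingIdeal_eq_closure, ← Set.image_image,
    vanishingIdeal_pointToPoint]
  ext x
  exact pointToPoint_mem_zeroLocus

/-- The conjugate of the block matrix with only nonzero block `A` in the lower left corner by the
unipotent matrix with upper right block `B`. -/
def conjBlock {L H K : Type*} [Fintype L] [Fintype H] [Ring K] (B : Matrix L H K)
    (A : Matrix H L K) : Matrix (L ⊕ H) (L ⊕ H) K :=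
  fromBlocks (B * A) (-(B * A * B)) A (-(A * B))

/-- The entries of a tuple of matrices, after relabelling rows and columns. -/
def tupleEntries {ι S N K : Type*} (e : S ≃ N) (M : ι → Matrix S S K) (q : ι × N × N) : K :=
  M q.1 (e.symm q.2.1) (e.symm q.2.2)

section
variable {k L H N ι : Type*} [Field k] [Fintype L] [Fintype H]

theorem map_aeval_tupleEntries {S A A' : Type*} [CommRing A] [CommRing A'] [Algebra k A]
    [Algebra k A'] (f : A →ₐ[k] A') (e : S ≃ N) (M : ι → Matrix S S A)
    (p : MvPolynomial (ι × N × N) k) :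
    f (aeval (tupleEntries e M) p) = aeval (tupleEntries e fun l => (M l).map f) p :=
  comp_aeval_apply _ f p

theorem conjBlock_eq [DecidableEq L] [DecidableEq H] {K : Type*} [Ring K]
    (B : Matrix L H K) (A : Matrix H L K) :
    conjBlock B A = fromBlocks 1 B 0 1 * fromBlocks 0 0 A 0 * fromBlocks 1 (-B) 0 1 := by
  simp [conjBlock, fromBlocks_multiply]

theorem conjBlock_map {K K' F : Type*} [Ring K] [Ring K'] [FunLike F K K']
    [RingHomClass F K K'] (f : F) (B : Matrix L H K) (A : Matrix H L K) :
    (conjBlock B A).map f = conjBlock (B.map f) (A.map f) := by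
  simp only [conjBlock, fromBlocks_map, ← Matrix.map_mul, Matrix.map_neg _ (map_neg f)]

variable (k L H ι) in
/-- The generic `L × H` matrix, with the variables in the second summand as entries. -/
noncomputable def genericB : Matrix L H (MvPolynomial ((ι × H × L) ⊕ (L × H)) k) :=
  of fun i j => X (.inr (i, j))

variable (k L H) in
/-- The generic tuple of `H × L` matrices, with the variables in the first summand as entries. -/
noncomputable def genericA (l : ι) : Matrix H L (MvPolynomial ((ι × H × L) ⊕ (L × H)) k) :=
  of fun i j => X (.inl (l, i, j))

variable (k ι) in
/-- The comorphism of the map sending `(A, B)` to the tuple `conjBlock B (A l)`. -/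
noncomputable def chartHom (e : L ⊕ H ≃ N) :
    MvPolynomial (ι × N × N) k →ₐ[k] MvPolynomial ((ι × H × L) ⊕ (L × H)) k :=
  aeval (tupleEntries e fun l => conjBlock (genericB k L H ι) (genericA k L H l))

theorem aeval_chartHom (e : L ⊕ H ≃ N) (t : (ι × H × L) ⊕ (L × H) → k)
    (p : MvPolynomial (ι × N × N) k) :
    aeval t (chartHom k ι e p) = aeval (tupleEntries e fun l =>
      conjBlock (of fun i j => t (.inr (i, j))) (of fun i j => t (.inl (l, i, j)))) p := by
  rw [chartHom, map_aeval_tupleEntries]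
  congr 3 with l : 1
  rw [conjBlock_map]
  congr 1 <;> ext <;> simp [genericB, genericA]

theorem chartHom_eq_zero_iff [Infinite k] (e : L ⊕ H ≃ N) (p : MvPolynomial (ι × N × N) k) :
    chartHom k ι e p = 0 ↔ ∀ (B : Matrix L H k) (A : ι → Matrix H L k),
      aeval (tupleEntries e fun l => conjBlock B (A l)) p = 0 := by
  constructor
  · intro h B A
    have := aeval_chartHom e (Sum.elim (fun x => A x.1 x.2.1 x.2.2) (fun x => B x.1 x.2)) p
    rw [h, map_zero] at this
    exact this.symm
  · intro h
    refine MvPolynomial.funext fun t => ?_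
    rw [map_zero]
    exact (aeval_chartHom e t p).trans (h _ _)

theorem Subalgebra.adjugate_mem {R A n : Type*} [CommRing R] [CommRing A] [Algebra R A]
    [Fintype n] [DecidableEq n] (S : Subalgebra R A) {M : Matrix n n A} (hM : ∀ i j, M i j ∈ S)
    (i j : n) : M.adjugate i j ∈ S := by
  let M' : Matrix n n S := of fun i j => ⟨M i j, hM i j⟩
  have : M = S.val.toRingHom.mapMatrix M' := rfl
  rw [this, ← RingHom.map_adjugate]
  exact (M'.adjugate i j).2

theorem Subalgebra.det_mem {R A n : Type*} [CommRing R] [CommRing A] [Algebra R A] [Fintype n]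
    [DecidableEq n] (S : Subalgebra R A) {M : Matrix n n A} (hM : ∀ i j, M i j ∈ S) :
    M.det ∈ S := by
  let M' : Matrix n n S := of fun i j => ⟨M i j, hM i j⟩
  have : M = S.val.toRingHom.mapMatrix M' := rfl
  rw [this, ← RingHom.map_det]
  exact M'.det.2

/-- The map whose comorphism is `chartHom` is generically finite. -/
theorem isAlgebraic_chartHom_range (e : L ⊕ H ≃ N) (i₀ : ι) (s : H ↪ L) :
    Algebra.IsAlgebraic (chartHom k ι e).range (MvPolynomial ((ι × H × L) ⊕ (L × H)) k) := by
  classical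
  set R := (chartHom k ι e).range
  have hentry : ∀ l i j, conjBlock (genericB k L H ι) (genericA k L H l) i j ∈ R := by
    intro l i j
    exact ⟨X (l, e i, e j), by simp [chartHom, tupleEntries]⟩
  have hA : ∀ l i j, genericA k L H l i j ∈ R := fun l i j => hentry l (.inr i) (.inl j)
  have hBA : ∀ l i j, (genericB k L H ι * genericA k L H l : Matrix L L _) i j ∈ R :=
    fun l i j => hentry l (.inl i) (.inl j)
  have halg : ∀ {x}, x ∈ R → IsAlgebraic R x :=
    fun {x} hx => isAlgebraic_algebraMap (⟨x, hx⟩ : R)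
  set M := (genericA k L H i₀).submatrix id s with hMdef
  have hM : ∀ i j, M i j ∈ R := fun i j => hA _ _ _
  have hdet : M.det ≠ 0 := by
    intro h
    have h2 := congrArg (aeval (Sum.elim (fun x => if s x.2.1 = x.2.2 then 1 else 0) fun _ => 0) :
      MvPolynomial ((ι × H × L) ⊕ (L × H)) k →ₐ[k] k) h
    rw [AlgHom.map_det, map_zero] at h2
    have h3 : (aeval (Sum.elim (fun x => if s x.2.1 = x.2.2 then 1 else 0) fun _ => 0) :
      MvPolynomial ((ι × H × L) ⊕ (L × H)) k →ₐ[k] k).mapMatrix M = 1 := by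
      ext i j
      simp [M, genericA, Matrix.one_apply]
    simp [h3] at h2
  have hB : ∀ i j, IsAlgebraic R (genericB k L H ι i j) := by
    intro i j
    refine IsAlgebraic.of_mul (mem_nonZeroDivisors_of_ne_zero hdet) (halg (R.det_mem hM)) (halg ?_)
    have h1 : (genericB k L H ι * genericA k L H i₀).submatrix id s * M.adjugate =
        M.det • genericB k L H ι := by
      have h0 : (genericB k L H ι * genericA k L H i₀).submatrix id s =
          genericB k L H ι * M := rfl
      rw [h0, Matrix.mul_assoc, mul_adjugate]
      simp
    have h2 := congrFun₂ h1 i j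
    rw [Matrix.smul_apply, smul_eq_mul] at h2
    rw [← h2, Matrix.mul_apply]
    exact sum_mem fun m _ => mul_mem (hBA _ _ _) (R.adjugate_mem hM _ _)
  refine ⟨fun x => ?_⟩
  induction x using MvPolynomial.induction_on with
  | C a => exact halg (R.algebraMap_mem a)
  | add p q hp hq => exact hp.add hq
  | mul_X p i hp =>
    refine hp.mul ?_
    rcases i with ⟨l, i, j⟩ | ⟨i, j⟩
    · exact halg (hA l i j)
    · exact hB i j

end

section
variable {k L H N ι : Type*} [Field k] [Fintype L] [Fintype H] [DecidableEq L] [DecidableEq H]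

/-- If `g` and its lower right block are invertible, then conjugating by `g` amounts to
conjugating by a unipotent matrix, up to changing the lower left block. -/
theorem exists_conj_eq_conjBlock (g : Matrix (L ⊕ H) (L ⊕ H) k) (hg : g.det ≠ 0)
    (hg' : g.toBlocks₂₂.det ≠ 0) : ∃ (B : Matrix L H k) (s : Matrix L L k), ∀ A : Matrix H L k,
      g * fromBlocks 0 0 A 0 * g⁻¹ = conjBlock B (g.toBlocks₂₂ * A * s) := by
  obtain ⟨a, b, c, d, rfl⟩ : ∃ a b c d, g = fromBlocks a b c d :=
    ⟨_, _, _, _, (fromBlocks_toBlocks g).symm⟩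
  rw [toBlocks_fromBlocks₂₂] at hg' ⊢
  have hd : IsUnit d.det := hg'.isUnit
  have := invertibleOfIsUnitDet d hd
  have hgu : IsUnit (fromBlocks a b c d).det := hg.isUnit
  rw [det_fromBlocks₂₂] at hg
  have hs := (right_ne_zero_of_mul hg).isUnit
  rw [invOf_eq_nonsing_inv] at hs
  have := invertibleOfIsUnitDet _ hgu
  refine ⟨b * d⁻¹, (a - b * d⁻¹ * c)⁻¹, fun A => ?_⟩
  rw [mul_inv_eq_iff_eq_mul_of_invertible]
  have h1 : fromBlocks (1 : Matrix L L k) (-(b * d⁻¹)) 0 1 * fromBlocks a b c d =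
      fromBlocks (a - b * d⁻¹ * c) 0 c d := by
    simp [fromBlocks_multiply, Matrix.mul_assoc, nonsing_inv_mul d hd, ← sub_eq_add_neg]
  rw [conjBlock_eq, Matrix.mul_assoc, h1, Matrix.mul_assoc]
  simp [fromBlocks_multiply, Matrix.mul_assoc, nonsing_inv_mul_cancel_left d _ hd]
  simp [← Matrix.mul_assoc, nonsing_inv_mul_cancel_right _ _ hs]

/-- A polynomial vanishing on all `conjBlock B (A l)` vanishes on all conjugates of tuples of
strictly lower left block matrices. -/
theorem aeval_conj_eq_zero [Infinite k] (e : L ⊕ H ≃ N) (p : MvPolynomial (ι × N × N) k)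
    (hp : ∀ (B : Matrix L H k) (A : ι → Matrix H L k),
      aeval (tupleEntries e fun l => conjBlock B (A l)) p = 0)
    (g : Matrix (L ⊕ H) (L ⊕ H) k) (hg : g.det ≠ 0) (A : ι → Matrix H L k) :
    aeval (tupleEntries e fun l => g * fromBlocks 0 0 (A l) 0 * g⁻¹) p = 0 := by
  have hgen : ∀ (g : Matrix (L ⊕ H) (L ⊕ H) k), g.det ≠ 0 → g.toBlocks₂₂.det ≠ 0 →
      ∀ A : ι → Matrix H L k,
        aeval (tupleEntries e fun l => g * fromBlocks 0 0 (A l) 0 * g⁻¹) p = 0 := by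
    intro g h1 h2 A
    obtain ⟨B, s, h⟩ := exists_conj_eq_conjBlock g h1 h2
    simp only [h]
    exact hp B fun l => g.toBlocks₂₂ * A l * s
  have hscale : ∀ (g : Matrix (L ⊕ H) (L ⊕ H) k) (A : Matrix H L k), g.det ≠ 0 →
      g * fromBlocks 0 0 A 0 * g.adjugate = g * fromBlocks 0 0 (g.det • A) 0 * g⁻¹ := by
    intro g A h
    have h1 : fromBlocks 0 0 (g.det • A) 0 =
        g.det • (fromBlocks 0 0 A 0 : Matrix (L ⊕ H) (L ⊕ H) k) := by
      simp [fromBlocks_smul]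
    rw [h1, Matrix.inv_def, Ring.inverse_eq_inv']
    simp [smul_smul, h]
  let G : Matrix (L ⊕ H) (L ⊕ H) (Polynomial k) :=
    1 + (Polynomial.X : Polynomial k) • (g - 1).map Polynomial.C
  have hG : ∀ s : k, (Polynomial.aeval s).mapMatrix G = 1 + s • (g - 1) := by
    intro s
    ext i j
    by_cases h : i = j
    · subst h
      simp [G, mul_comm s]
    · simp [G, h, mul_comm s]
  have hG' : ∀ s : k, (Polynomial.aeval s).mapMatrix G.toBlocks₂₂ =
      (1 + s • (g - 1)).toBlocks₂₂ := by
    intro s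
    rw [← hG]
    rfl
  let P : (ι → Matrix H L k) → Polynomial k := fun A => aeval (tupleEntries e fun l =>
    G * (fromBlocks 0 0 (A l) 0).map Polynomial.C * G.adjugate) p
  have hP : ∀ (s : k) A, Polynomial.aeval s (P A) =
      aeval (tupleEntries e fun l => (1 + s • (g - 1)) * fromBlocks 0 0 (A l) 0 *
      (1 + s • (g - 1)).adjugate) p := by
    intro s A
    rw [map_aeval_tupleEntries]
    congr 3 with l : 1
    rw [Matrix.map_mul, Matrix.map_mul, ← hG, ← AlgHom.map_adjugate, Matrix.map_map]
    congr 3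
    ext i j
    simp
  have hP0 : ∀ A, P A = 0 := by
    intro A
    have hd : G.det ≠ 0 := fun h => by
      have := congrArg (Polynomial.aeval (0 : k)) h
      rw [AlgHom.map_det, hG] at this
      simp at this
    have hd' : G.toBlocks₂₂.det ≠ 0 := fun h => by
      have := congrArg (Polynomial.aeval (0 : k)) h
      rw [AlgHom.map_det, hG'] at this
      have h1 : (1 : Matrix (L ⊕ H) (L ⊕ H) k).toBlocks₂₂ = 1 := by
        rw [← fromBlocks_one, toBlocks_fromBlocks₂₂]
      simp [h1] at this
    have : P A * (G.det * G.toBlocks₂₂.det) = 0 := by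
      refine Polynomial.funext fun s => ?_
      simp only [← Polynomial.coe_aeval_eq_eval, map_mul, map_zero, AlgHom.map_det, hG, hG', hP]
      by_cases h1 : (1 + s • (g - 1)).det = 0
      · simp [h1]
      by_cases h2 : (1 + s • (g - 1)).toBlocks₂₂.det = 0
      · simp [h2]
      simp only [hscale _ _ h1]
      rw [hgen _ h1 h2 fun l => (1 + s • (g - 1)).det • A l, zero_mul]
    simpa [hd, hd'] using this
  have h1 := hP 1 fun l => g.det⁻¹ • A l
  rw [hP0, map_zero] at h1
  simpa [hscale _ _ hg, hg, smul_smul] using h1.symm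

end

theorem trdeg_chartHom_range {k L H N ι : Type*} [Field k] [Fintype L] [Fintype H] [Fintype ι]
    (e : L ⊕ H ≃ N) (i₀ : ι) (s : H ↪ L) :
    Algebra.trdeg k (chartHom k ι e).range =
      (Fintype.card ι * (Fintype.card H * Fintype.card L) +
        Fintype.card L * Fintype.card H : ℕ) := by
  have := isAlgebraic_chartHom_range (k := k) e i₀ s
  have h1 := lift_trdeg_add_eq k (chartHom k ι e).range
    (MvPolynomial ((ι × H × L) ⊕ (L × H)) k)
  rw [trdeg_eq_zero (R := (chartHom k ι e).range), MvPolynomial.trdeg_of_isDomain] at h1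
  simpa using h1

theorem ringKrullDim_quotient_ker_chartHom {k L H N ι : Type*} [Field k] [Fintype L] [Fintype H]
    [Fintype ι] [Finite N] (e : L ⊕ H ≃ N) (i₀ : ι) (s : H ↪ L) :
    ringKrullDim (MvPolynomial (ι × N × N) k ⧸ RingHom.ker (chartHom k ι e)) =
      (Fintype.card ι * (Fintype.card H * Fintype.card L) +
        Fintype.card L * Fintype.card H : ℕ) := by
  have : Algebra.FiniteType k (chartHom k ι e).range :=
    .of_surjective (chartHom k ι e).rangeRestrict (chartHom k ι e).rangeRestrict_surjective
  rw [ringKrullDim_eq_of_ringEquiv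
    (Ideal.quotientKerEquivRange (chartHom k ι e)).toRingEquiv]
  exact ringKrullDim_eq_of_trdeg k _ _ (trdeg_chartHom_range e i₀ s)

/-- The coordinates of a tuple of matrices. -/
def tupleCoord (k : Type*) (n r : ℕ) :
    (Fin r → Matrix (Fin n) (Fin n) k) ≃ (Fin r × Fin n × Fin n → k) where
  toFun x q := x q.1 q.2.1 q.2.2
  invFun f l := of fun i j => f (l, i, j)
  left_inv _ := rfl
  right_inv _ := rfl

/-- The tuples of matrices which are simultaneously conjugate to a tuple from `u_P`. -/
def conjTuples (k : Type*) [Field k] (n r : ℕ) : Set (Fin r → Matrix (Fin n) (Fin n) k) :=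
  {y | ∃ g : (Matrix (Fin n) (Fin n) k)ˣ,
    ∃ x : Fin r → Matrix (Fin n) (Fin n) k, (∀ i, x i ∈ uP k n) ∧
      y = fun i => (g : Matrix (Fin n) (Fin n) k) * x i * (↑g⁻¹ : Matrix (Fin n) (Fin n) k)}

/-- The splitting of the indices into those below `⌈n/2⌉` and the others. -/
def halfEquiv (n : ℕ) : Fin ((n + 1) / 2) ⊕ Fin (n / 2) ≃ Fin n :=
  finSumFinEquiv.trans (finCongr (by omega))

theorem mem_uP_iff {k : Type*} [Field k] {n : ℕ} {x : Matrix (Fin n) (Fin n) k} :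
    x ∈ uP k n ↔ ∃ A, x.submatrix (halfEquiv n) (halfEquiv n) = fromBlocks 0 0 A 0 := by
  constructor
  · intro h
    refine ⟨(x.submatrix (halfEquiv n) (halfEquiv n)).toBlocks₂₁, ?_⟩
    ext (i | i) (j | j)
    · exact h _ _ (.inl (by simp [halfEquiv]))
    · exact h _ _ (.inl (by simp [halfEquiv]))
    · rfl
    · exact h _ _ (.inr (by simp [halfEquiv]))
  · rintro ⟨A, hA⟩ i j hij
    obtain ⟨i, rfl⟩ := (halfEquiv n).surjective i
    obtain ⟨j, rfl⟩ := (halfEquiv n).surjective j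
    have h := congrFun₂ hA i j
    rw [submatrix_apply] at h
    rw [h]
    rcases i with i | i <;> rcases j with j | j <;> try rfl
    have := j.2
    simp [halfEquiv] at hij
    omega

theorem tupleCoord_eq_tupleEntries {k : Type*} {n r : ℕ} {S : Type*} (e : S ≃ Fin n)
    (x : Fin r → Matrix (Fin n) (Fin n) k) :
    tupleCoord k n r x = tupleEntries e fun l => (x l).submatrix e e := by
  ext q
  simp only [tupleEntries, submatrix_apply, Equiv.apply_symm_apply]
  rfl

/-- The vanishing ideal of the set of conjugates is the kernel of the comorphism `chartHom`. -/
theorem vanishingIdeal_conjTuples (k : Type*) [Field k] [Infinite k] (n r : ℕ) :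
    vanishingIdeal k (tupleCoord k n r '' conjTuples k n r) =
      RingHom.ker (chartHom k (Fin r) (halfEquiv n)) := by
  ext p
  rw [mem_vanishingIdeal_iff, RingHom.mem_ker, chartHom_eq_zero_iff, Set.forall_mem_image]
  constructor
  · intro h B A
    let u : (Matrix (Fin ((n + 1) / 2) ⊕ Fin (n / 2)) (Fin ((n + 1) / 2) ⊕ Fin (n / 2)) k)ˣ :=
      ⟨fromBlocks 1 B 0 1, fromBlocks 1 (-B) 0 1, by simp [fromBlocks_multiply],
        by simp [fromBlocks_multiply]⟩
    let g := Units.map (reindexAlgEquiv k k (halfEquiv n)).toAlgHom.toMonoidHom u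
    have := h ⟨g, fun l => (fromBlocks 0 0 (A l) 0).submatrix (halfEquiv n).symm (halfEquiv n).symm,
      fun l => mem_uP_iff.2 ⟨A l, by simp⟩, rfl⟩
    rw [tupleCoord_eq_tupleEntries (halfEquiv n)] at this
    convert! this using 4
    ext1 l
    dsimp only
    rw [conjBlock_eq, ← submatrix_mul_equiv _ _ _ (halfEquiv n),
      ← submatrix_mul_equiv _ _ _ (halfEquiv n)]
    simp [g, u, Units.inv_mk]
  · rintro h _ ⟨g, x, hx, rfl⟩
    choose A hA using fun l => mem_uP_iff.1 (hx l)
    have hg : ((g : Matrix (Fin n) (Fin n) k).submatrix (halfEquiv n) (halfEquiv n)).det ≠ 0 := by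
      rw [det_submatrix_equiv_self]
      exact ((isUnit_iff_isUnit_det _).1 g.isUnit).ne_zero
    rw [tupleCoord_eq_tupleEntries (halfEquiv n), ← aeval_conj_eq_zero (halfEquiv n) p h _ hg A]
    congr 3 with l : 1
    rw [← hA, ← submatrix_mul_equiv _ _ _ (halfEquiv n), ← submatrix_mul_equiv _ _ _ (halfEquiv n),
      inv_submatrix_equiv, coe_units_inv]

/-- For all integers `n ≥ 2` and `r ≥ 1`, the set `V_P` is irreducible and
`dim V_P = (r+1)·⌊n²/4⌋` (that is, `(r+1)m²` if `n = 2m` and `(r+1)m(m+1)` if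
`n = 2m+1`). -/
theorem VP_irreducible_dim (k : Type*) [Field k] [IsAlgClosed k]
    (n r : ℕ) (hn : 2 ≤ n) (hr : 1 ≤ r) :
    letI := matTupleZariski k n r
    IsIrreducible (VP k n r) ∧
      topologicalKrullDim (VP k n r) = ((r + 1) * (n ^ 2 / 4) : ℕ) := by
  let := matTupleZariski k n r
  have hVP : VP k n r = tupleCoord k n r ⁻¹'
      zeroLocus k (RingHom.ker (chartHom k (Fin r) (halfEquiv n))) := by
    rw [← vanishingIdeal_conjTuples]
    exact closure_eq_preimage_zeroLocus (tupleCoord k n r) rfl (conjTuples k n r)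
  have := RingHom.ker_isPrime (chartHom k (Fin r) (halfEquiv n))
  rw [hVP]
  refine ⟨isIrreducible_preimage_zeroLocus _ rfl _, ?_⟩
  refine (topologicalKrullDim_preimage_zeroLocus (tupleCoord k n r) rfl _).trans ?_
  rw [ringKrullDim_quotient_ker_chartHom _ ⟨0, hr⟩ (Fin.castLEEmb (by omega))]
  have h : (n + 1) / 2 * (n / 2) = n ^ 2 / 4 := by
    obtain ⟨m, rfl | rfl⟩ := n.even_or_odd'
    · rw [show (2 * m + 1) / 2 = m by omega, show 2 * m / 2 = m by omega,
        show (2 * m) ^ 2 = 4 * (m * m) by ring]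
      omega
    · rw [show (2 * m + 1 + 1) / 2 = m + 1 by omega, show (2 * m + 1) / 2 = m by omega,
        show (2 * m + 1) ^ 2 = 4 * ((m + 1) * m) + 1 by ring]
      omega
  congr 1
  simp only [Fintype.card_fin, ← h]
  ring
end

section
/- For every integer s ≥ 1 and n = 4s, dim C_3(N_n) ≥ n² + s² = 17s². -/
open MvPolynomial Matrix TopologicalSpace

/-- `C_r(N_n)`: the set of commuting `r`-tuples of nilpotent `n × n` matrices. -/
def nilCommTuples (k : Type*) [Field k] (n r : ℕ) :
    Set (Fin r → Matrix (Fin n) (Fin n) k) :=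
  {x | (∀ i, IsNilpotent (x i)) ∧ ∀ i j, x i * x j = x j * x i}

section Zariski

variable {k : Type*} [Field k] {D E σ τ : Type*}

/-- The Zariski topology on a type with coordinates `c : D → σ → k`, generated by complements
of hypersurfaces. -/
@[reducible]
def zariskiOf (c : D → σ → k) : TopologicalSpace D :=
  generateFrom {U | ∃ p : MvPolynomial σ k, U = {x | eval (c x) p ≠ 0}}

theorem induced_zariskiOf (f : D → E) (c : E → σ → k) :
    (zariskiOf c).induced f = zariskiOf (c ∘ f) := by
  unfold zariskiOf
  rw [induced_generateFrom_eq]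
  congr 1
  ext U
  constructor
  · rintro ⟨_, ⟨p, rfl⟩, rfl⟩
    exact ⟨p, rfl⟩
  · rintro ⟨p, rfl⟩
    exact ⟨_, ⟨p, rfl⟩, rfl⟩

/-- Functions on `D` that are globally quotients of polynomials in the coordinates `c`. -/
def regularFunctions (c : D → σ → k) : Subalgebra k (D → k) where
  carrier := {f | ∃ p q : MvPolynomial σ k,
    ∀ y, eval (c y) q ≠ 0 ∧ f y * eval (c y) q = eval (c y) p}
  mul_mem' := by
    rintro f g ⟨p, q, h⟩ ⟨p', q', h'⟩
    refine ⟨p * p', q * q', fun y => ⟨by simpa using ⟨(h y).1, (h' y).1⟩, ?_⟩⟩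
    simp only [Pi.mul_apply, map_mul, ← (h y).2, ← (h' y).2]
    ring
  add_mem' := by
    rintro f g ⟨p, q, h⟩ ⟨p', q', h'⟩
    refine ⟨p * q' + p' * q, q * q', fun y => ⟨by simpa using ⟨(h y).1, (h' y).1⟩, ?_⟩⟩
    simp only [Pi.add_apply, map_mul, map_add, ← (h y).2, ← (h' y).2]
    ring
  algebraMap_mem' r := ⟨C r, 1, fun y => by simp⟩

theorem coord_mem_regularFunctions (c : D → σ → k) (i : σ) :
    (fun y => c y i) ∈ regularFunctions c :=
  ⟨X i, 1, fun y => by simp⟩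

theorem inv_mem_regularFunctions {c : D → σ → k} {f : D → k} (hf : f ∈ regularFunctions c)
    (h0 : ∀ y, f y ≠ 0) : f⁻¹ ∈ regularFunctions c := by
  obtain ⟨p, q, h⟩ := hf
  refine ⟨q, p, fun y => ?_⟩
  rw [← (h y).2]
  exact ⟨mul_ne_zero (h0 y) (h y).1, by simp [h0 y]⟩

theorem eval_mem_regularFunctions {c : D → σ → k} {c' : D → τ → k}
    (h : ∀ j, (fun y => c' y j) ∈ regularFunctions c) (p : MvPolynomial τ k) :
    (fun y => eval (c' y) p) ∈ regularFunctions c := by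
  induction p using MvPolynomial.induction_on with
  | C a =>
    simp only [eval_C]
    exact (regularFunctions c).algebraMap_mem a
  | add p q hp hq =>
    simp only [map_add]
    exact (regularFunctions c).add_mem hp hq
  | mul_X p i hp =>
    simp only [map_mul, eval_X]
    exact (regularFunctions c).mul_mem hp (h i)

theorem zariskiOf_le_of_regular {c : D → σ → k} {c' : D → τ → k}
    (h : ∀ j, (fun y => c' y j) ∈ regularFunctions c) : zariskiOf c ≤ zariskiOf c' := by
  refine le_generateFrom ?_
  rintro _ ⟨p, rfl⟩
  obtain ⟨r, q, hr⟩ := eval_mem_regularFunctions h p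
  refine GenerateOpen.basic _ ⟨r, ?_⟩
  ext y
  simp [← (hr y).2, (hr y).1]

theorem exists_polynomial_eval_line (p : MvPolynomial σ k) (a b : σ → k) :
    ∃ P : Polynomial k, ∀ t, P.eval t = eval (a + t • b) p := by
  refine ⟨aeval (fun i => Polynomial.C (a i) + Polynomial.X * Polynomial.C (b i)) p, fun t => ?_⟩
  induction p using MvPolynomial.induction_on with
  | C a => simp
  | add p q hp hq => simp only [map_add, Polynomial.eval_add, hp, hq]
  | mul_X p i hp => simp [-Polynomial.X_mul_C, hp]

theorem isTopologicalBasis_zariskiOf (c : D → σ → k) :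
    @IsTopologicalBasis D (zariskiOf c) {U | ∃ p : MvPolynomial σ k, U = {x | eval (c x) p ≠ 0}} := by
  let := zariskiOf c
  refine isTopologicalBasis_of_subbasis_of_finiteInter rfl (FiniteInter.mk ⟨1, by simp⟩ ?_)
  rintro _ ⟨p, rfl⟩ _ ⟨q, rfl⟩
  exact ⟨p * q, by ext; simp⟩

/-- A nonempty principal open subset of affine space over an infinite field meets every affine
coordinate subspace in an irreducible set. -/
theorem isPreirreducible_coordinate_section [Infinite k] (d : MvPolynomial σ k) (J : Set σ)
    (y₀ : σ → k) :
    letI := zariskiOf (fun y : {y : σ → k // eval y d ≠ 0} => y.1)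
    IsPreirreducible {y : {y : σ → k // eval y d ≠ 0} | ∀ j ∈ J, y.1 j = y₀ j} := by
  let := zariskiOf (fun y : {y : σ → k // eval y d ≠ 0} => y.1)
  intro U V hU hV ⟨a, haJ, haU⟩ ⟨b, hbJ, hbV⟩
  have hB := isTopologicalBasis_zariskiOf (fun y : {y : σ → k // eval y d ≠ 0} => y.1)
  obtain ⟨_, ⟨p, rfl⟩, hap, hpU⟩ := hB.exists_subset_of_mem_open haU hU
  obtain ⟨_, ⟨q, rfl⟩, hbq, hqV⟩ := hB.exists_subset_of_mem_open hbV hV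
  obtain ⟨P, hP⟩ := exists_polynomial_eval_line p a.1 (b.1 - a.1)
  obtain ⟨Q, hQ⟩ := exists_polynomial_eval_line q a.1 (b.1 - a.1)
  obtain ⟨R, hR⟩ := exists_polynomial_eval_line d a.1 (b.1 - a.1)
  have hP0 : P ≠ 0 := by
    rintro rfl
    exact hap (by simpa using (hP 0).symm)
  have hQ0 : Q ≠ 0 := by
    rintro rfl
    exact hbq (by simpa using (hQ 1).symm)
  have hR0 : R ≠ 0 := by
    rintro rfl
    exact a.2 (by simpa using (hR 0).symm)
  obtain ⟨t, ht⟩ : ∃ t, (P * Q * R).eval t ≠ 0 := by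
    by_contra! h
    exact mul_ne_zero (mul_ne_zero hP0 hQ0) hR0 (Polynomial.funext fun t => by simpa using h t)
  simp only [Polynomial.eval_mul, hP, hQ, hR, mul_ne_zero_iff] at ht
  refine ⟨⟨_, ht.2⟩, fun j hj => ?_, hpU ht.1.1, hqV ht.1.2⟩
  simp [haJ j hj, hbJ j hj]

theorem isClosed_coordinate_section (c : D → σ → k) (J : Set σ) (y₀ : σ → k) :
    @IsClosed D (zariskiOf c) {y | ∀ j ∈ J, c y j = y₀ j} := by
  let := zariskiOf c
  simp only [Set.ofPred_forall]
  refine isClosed_biInter fun j _ => ⟨GenerateOpen.basic _ ⟨X j - C (y₀ j), ?_⟩⟩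
  ext y
  simp [sub_eq_zero]

/-- A nonempty principal open subset of an affine space has at least the expected dimension. -/
theorem card_le_topologicalKrullDim [Infinite k] [Fintype σ] (d : MvPolynomial σ k) (y₀ : σ → k)
    (h₀ : eval y₀ d ≠ 0) :
    ((Fintype.card σ : ℕ) : WithBot ℕ∞) ≤ @topologicalKrullDim {y : σ → k // eval y d ≠ 0}
      (zariskiOf fun y => y.1) := by
  let := zariskiOf (fun y : {y : σ → k // eval y d ≠ 0} => y.1)
  let e := Fintype.equivFin σ
  let J : Fin (Fintype.card σ + 1) → Set σ := fun i => {j | (i : ℕ) ≤ e j}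
  let Z : Fin (Fintype.card σ + 1) → IrreducibleCloseds {y : σ → k // eval y d ≠ 0} := fun i =>
    ⟨{y | ∀ j ∈ J i, y.1 j = y₀ j}, ⟨⟨⟨y₀, h₀⟩, fun _ _ => rfl⟩,
      isPreirreducible_coordinate_section d (J i) y₀⟩, isClosed_coordinate_section _ _ _⟩
  have hZ : StrictMono Z := by
    refine Fin.strictMono_iff_lt_succ.2 fun i => ?_
    rw [← SetLike.coe_ssubset_coe]
    refine ⟨fun y hy j hj => hy j (Nat.le_of_succ_le hj), fun hsub => ?_⟩
    classical
    obtain ⟨R, hR⟩ := exists_polynomial_eval_line d y₀ (Pi.single (e.symm i) 1)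
    have hR0 : R ≠ 0 := by
      rintro rfl
      exact h₀ (by simpa using (hR 0).symm)
    obtain ⟨t, ht⟩ : ∃ t, (R * Polynomial.X).eval t ≠ 0 := by
      by_contra! h
      exact mul_ne_zero hR0 Polynomial.X_ne_zero (Polynomial.funext fun t => by simpa using h t)
    simp only [Polynomial.eval_mul, hR, Polynomial.eval_X, mul_ne_zero_iff] at ht
    have hmem : (⟨_, ht.1⟩ : {y : σ → k // eval y d ≠ 0}) ∈ Z i.succ := by
      intro j hj
      have hne : j ≠ e.symm i := by
        rintro rfl
        simp [J] at hj
      simp [hne]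
    have := hsub hmem (e.symm i) (by simp [J])
    simp [ht.2] at this
  exact Order.le_krullDim_iff.2 ⟨LTSeries.mk _ Z hZ, rfl⟩

end Zariski

section RegularMatrices

variable {k : Type*} [Field k] {D σ l m n : Type*}

/-- Families of matrices whose entries are regular functions in the coordinates `c`. -/
def IsRegularFamily (c : D → σ → k) (F : D → Matrix m n k) : Prop :=
  ∀ i j, (fun y => F y i j) ∈ regularFunctions c

variable {c : D → σ → k}

theorem isRegularFamily_const (A : Matrix m n k) : IsRegularFamily c fun _ => A :=
  fun i j => (regularFunctions c).algebraMap_mem (A i j)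

theorem IsRegularFamily.add {F G : D → Matrix m n k} (hF : IsRegularFamily c F)
    (hG : IsRegularFamily c G) : IsRegularFamily c fun y => F y + G y :=
  fun i j => (regularFunctions c).add_mem (hF i j) (hG i j)

theorem IsRegularFamily.mul [Fintype m] {F : D → Matrix l m k} {G : D → Matrix m n k}
    (hF : IsRegularFamily c F) (hG : IsRegularFamily c G) :
    IsRegularFamily c fun y => F y * G y := by
  intro i j
  convert! (regularFunctions c).sum_mem
    (fun a (_ : a ∈ Finset.univ) => (regularFunctions c).mul_mem (hF i a) (hG a j)) using 1
  ext y
  simp [Matrix.mul_apply]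

theorem IsRegularFamily.det [Fintype n] [DecidableEq n] {F : D → Matrix n n k}
    (hF : IsRegularFamily c F) : (fun y => (F y).det) ∈ regularFunctions c := by
  convert! (regularFunctions c).sum_mem
    (fun π (_ : π ∈ (Finset.univ : Finset (Equiv.Perm n))) => (regularFunctions c).mul_mem
      ((regularFunctions c).algebraMap_mem ((Equiv.Perm.sign π : ℤ) : k))
      ((regularFunctions c).prod_mem fun i (_ : i ∈ Finset.univ) => hF (π i) i)) using 1
  ext y
  simp [Matrix.det_apply']

theorem IsRegularFamily.inv [Fintype n] [DecidableEq n] {F : D → Matrix n n k}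
    (hF : IsRegularFamily c F) (h0 : ∀ y, (F y).det ≠ 0) :
    IsRegularFamily c fun y => (F y)⁻¹ := by
  intro i j
  have hadj : (fun y => (F y).adjugate i j) ∈ regularFunctions c := by
    simp only [Matrix.adjugate_apply]
    refine IsRegularFamily.det fun a b => ?_
    by_cases ha : a = j
    · subst ha
      simp only [Matrix.updateRow_self]
      exact (regularFunctions c).algebraMap_mem ((Pi.single i 1 : n → k) b)
    · simpa [Matrix.updateRow_ne ha] using hF a b
  convert! (regularFunctions c).mul_mem (inv_mem_regularFunctions hF.det h0) hadj using 1
  ext y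
  simp [Matrix.inv_def]

theorem isRegularFamily_comp {I J : Type*} {F : D → Matrix I I (Matrix J J k)}
    (hF : ∀ a b, IsRegularFamily c fun y => F y a b) :
    IsRegularFamily c fun y => Matrix.comp I I J J k (F y) :=
  fun i j => hF i.1 j.1 i.2 j.2

end RegularMatrices

section NormalForm

variable {S : Type*} [Ring S]

/-- Left multiplication by `x` in the basis `1, x, y, x²` of the algebra with relations
`x y = w x²`, `y² = v x²`. -/
def normalX (w : S) : Matrix (Fin 4) (Fin 4) S :=
  !![0, 0, 0, 0; 1, 0, 0, 0; 0, 0, 0, 0; 0, 1, w, 0]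

/-- Left multiplication by `y` in the basis `1, x, y, x²` of the algebra with relations
`x y = w x²`, `y² = v x²`. -/
def normalY (w v : S) : Matrix (Fin 4) (Fin 4) S :=
  !![0, 0, 0, 0; 0, 0, 0, 0; 1, 0, 0, 0; 0, w, v, 0]

/-- The nilpotent matrix with first column `0, p, q, r` that commutes with `normalX w` and
`normalY w v`. -/
def normalZ (w v p q r : S) : Matrix (Fin 4) (Fin 4) S :=
  !![0, 0, 0, 0; p, 0, 0, 0; q, 0, 0, 0; r, p + w * q, w * p + v * q, 0]

/-- The three normal forms as a family. -/
def normalTriple (w v p q r : S) : Fin 3 → Matrix (Fin 4) (Fin 4) S :=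
  ![normalX w, normalY w v, normalZ w v p q r]

theorem normalTriple_commute (w v p q r : S) (i j : Fin 3) :
    normalTriple w v p q r i * normalTriple w v p q r j =
      normalTriple w v p q r j * normalTriple w v p q r i := by
  fin_cases i <;> fin_cases j <;> ext a b <;> fin_cases a <;> fin_cases b <;>
    simp [normalTriple, normalX, normalY, normalZ, Matrix.mul_apply, Fin.sum_univ_four]

theorem normalTriple_pow_three (w v p q r : S) (i : Fin 3) :
    normalTriple w v p q r i ^ 3 = 0 := by
  rw [pow_three]
  fin_cases i <;> ext a b <;> fin_cases a <;> fin_cases b <;>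
    simp [normalTriple, normalX, normalY, normalZ, Matrix.mul_apply, Fin.sum_univ_four]

end NormalForm

section Parametrization

/-- Parameters: the last three block columns of a frame, and five blocks of a normal form. -/
abbrev TripleParam (s : ℕ) : Type := ((Fin 4 × Fin s) × (Fin 3 × Fin s)) ⊕ (Fin 5 × Fin s × Fin s)

variable {s : ℕ}

/-- The square matrix whose first block column is standard and whose other block columns are
given by the parameters. -/
def frame {R : Type*} [CommRing R] (y : TripleParam s → R) :
    Matrix (Fin 4 × Fin s) (Fin 4 × Fin s) R :=
  Matrix.of fun i j => Fin.cases (if i = (0, j.2) then 1 else 0)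
    (fun t => y (Sum.inl (i, t, j.2))) j.1

@[simp]
theorem frame_zero {R : Type*} [CommRing R] (y : TripleParam s → R) (i b) :
    frame y i (0, b) = if i = (0, b) then 1 else 0 := rfl

@[simp]
theorem frame_succ {R : Type*} [CommRing R] (y : TripleParam s → R) (i t b) :
    frame y i (Fin.succ t, b) = y (Sum.inl (i, t, b)) := rfl

/-- The determinant of the generic frame. -/
noncomputable def frameDet (k : Type*) [Field k] (s : ℕ) : MvPolynomial (TripleParam s) k :=
  (frame X).det

variable {k : Type*} [Field k]

theorem eval_frameDet (y : TripleParam s → k) : eval y (frameDet k s) = (frame y).det := by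
  rw [frameDet, RingHom.map_det]
  congr 1
  ext i ⟨t, b⟩
  refine Fin.cases ?_ (fun t => ?_) t
  · by_cases h : i = (0, b) <;> simp [h]
  · simp

/-- The square blocks of the normal form. -/
def blockParam (y : TripleParam s → k) (t : Fin 5) : Matrix (Fin s) (Fin s) k :=
  Matrix.of fun a b => y (Sum.inr (t, a, b))

/-- The normal form triple attached to the parameters. -/
def blockTriple (y : TripleParam s → k) (i : Fin 3) :
    Matrix (Fin 4 × Fin s) (Fin 4 × Fin s) k :=
  Matrix.compRingEquiv (Fin 4) (Fin s) k (normalTriple (blockParam y 0) (blockParam y 1)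
    (blockParam y 2) (blockParam y 3) (blockParam y 4) i)

/-- The normal form triple transported along the frame. -/
noncomputable def framedTriple (y : TripleParam s → k) (i : Fin 3) :
    Matrix (Fin 4 × Fin s) (Fin 4 × Fin s) k :=
  frame y * blockTriple y i * (frame y)⁻¹

theorem framedTriple_mul_frame {y : TripleParam s → k} (hy : (frame y).det ≠ 0) (i : Fin 3) :
    framedTriple y i * frame y = frame y * blockTriple y i := by
  rw [framedTriple, Matrix.nonsing_inv_mul_cancel_right _ _ hy.isUnit]

theorem inv_mul_framedTriple_mul {y : TripleParam s → k} (hy : (frame y).det ≠ 0) (i : Fin 3) :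
    (frame y)⁻¹ * (framedTriple y i * frame y) = blockTriple y i := by
  rw [framedTriple_mul_frame hy, Matrix.nonsing_inv_mul_cancel_left _ _ hy.isUnit]

theorem framedTriple_mul_framedTriple {y : TripleParam s → k} (hy : (frame y).det ≠ 0)
    (i j : Fin 3) :
    framedTriple y i * framedTriple y j =
      frame y * (blockTriple y i * blockTriple y j) * (frame y)⁻¹ := by
  conv_lhs => rw [framedTriple.eq_1 y j, ← Matrix.mul_assoc, ← Matrix.mul_assoc,
    framedTriple_mul_frame hy]
  simp only [Matrix.mul_assoc]

theorem framedTriple_commute {y : TripleParam s → k} (hy : (frame y).det ≠ 0) (i j : Fin 3) :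
    framedTriple y i * framedTriple y j = framedTriple y j * framedTriple y i := by
  simp only [framedTriple_mul_framedTriple hy, blockTriple, ← map_mul]
  rw [normalTriple_commute]

theorem framedTriple_pow_three {y : TripleParam s → k} (hy : (frame y).det ≠ 0) (i : Fin 3) :
    framedTriple y i ^ 3 = 0 := by
  rw [pow_three, framedTriple_mul_framedTriple hy, ← Matrix.mul_assoc, ← Matrix.mul_assoc,
    framedTriple_mul_frame hy, Matrix.mul_assoc (frame y), ← pow_three, blockTriple, ← map_pow,
    normalTriple_pow_three, map_zero, Matrix.mul_zero, Matrix.zero_mul]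

theorem mul_frame_zero (A : Matrix (Fin 4 × Fin s) (Fin 4 × Fin s) k) (y : TripleParam s → k)
    (i b) : (A * frame y) i (0, b) = A i (0, b) := by
  simp [Matrix.mul_apply]

theorem mul_comp_apply_of_unit_column (A : Matrix (Fin 4 × Fin s) (Fin 4 × Fin s) k)
    {M : Matrix (Fin 4) (Fin 4) (Matrix (Fin s) (Fin s) k)} {a c : Fin 4}
    (hM : ∀ t, M t c = (1 : Matrix (Fin 4) (Fin 4) (Matrix (Fin s) (Fin s) k)) t a) (i b) :
    (A * Matrix.compRingEquiv (Fin 4) (Fin s) k M) i (c, b) = A i (a, b) := by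
  calc _ = (A * Matrix.compRingEquiv (Fin 4) (Fin s) k 1) i (a, b) := by
        simp only [Matrix.mul_apply, Matrix.compRingEquiv_apply, Matrix.comp_apply, hM]
    _ = A i (a, b) := by rw [map_one, Matrix.mul_one]

theorem framedTriple_zero_apply {y : TripleParam s → k} (hy : (frame y).det ≠ 0) (i b) :
    framedTriple y 0 i (0, b) = frame y i (1, b) := by
  rw [← mul_frame_zero (framedTriple y 0) y, framedTriple_mul_frame hy, blockTriple]
  exact mul_comp_apply_of_unit_column _ (fun t => by fin_cases t <;> rfl) i b

theorem framedTriple_one_apply {y : TripleParam s → k} (hy : (frame y).det ≠ 0) (i b) :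
    framedTriple y 1 i (0, b) = frame y i (2, b) := by
  rw [← mul_frame_zero (framedTriple y 1) y, framedTriple_mul_frame hy, blockTriple]
  exact mul_comp_apply_of_unit_column _ (fun t => by fin_cases t <;> rfl) i b

theorem framedTriple_zero_mul_self_apply {y : TripleParam s → k} (hy : (frame y).det ≠ 0) (i b) :
    (framedTriple y 0 * framedTriple y 0) i (0, b) = frame y i (3, b) := by
  rw [← mul_frame_zero (framedTriple y 0 * framedTriple y 0) y,
    framedTriple_mul_framedTriple hy, Matrix.nonsing_inv_mul_cancel_right _ _ hy.isUnit,
    blockTriple, ← map_mul]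
  refine mul_comp_apply_of_unit_column _ (fun t => ?_) i b
  fin_cases t <;> simp [normalTriple, normalX, Matrix.mul_apply, Fin.sum_univ_four]
  rfl

theorem isRegularFamily_framedTriple {D : Type*} {y : D → TripleParam s → k}
    (hy : ∀ x, (frame (y x)).det ≠ 0) (i : Fin 3) :
    IsRegularFamily y fun x => framedTriple (y x) i := by
  have hframe : IsRegularFamily y fun x => frame (y x) := by
    rintro a ⟨t, b⟩
    refine Fin.cases ?_ (fun t => ?_) t
    · exact (regularFunctions y).algebraMap_mem _
    · exact coord_mem_regularFunctions y _
  have hblock (t : Fin 5) : IsRegularFamily y fun x => blockParam (y x) t :=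
    fun _ _ => coord_mem_regularFunctions y _
  refine (hframe.mul (isRegularFamily_comp fun a b => ?_)).mul (hframe.inv hy)
  fin_cases i <;> fin_cases a <;> fin_cases b
  all_goals first
    | exact isRegularFamily_const _
    | exact hblock _
    | exact (hblock _).add ((hblock _).mul (hblock _))
    | exact ((hblock _).mul (hblock _)).add ((hblock _).mul (hblock _))

theorem param_mem_regularFunctions {D τ : Type*} {y : D → TripleParam s → k} {c : D → τ → k}
    (hy : ∀ x, (frame (y x)).det ≠ 0)
    (hc : ∀ i, IsRegularFamily c fun x => framedTriple (y x) i) (j : TripleParam s) :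
    (fun x => y x j) ∈ regularFunctions c := by
  have hframe : IsRegularFamily c fun x => frame (y x) := by
    rintro a ⟨t, b⟩
    fin_cases t
    · exact (regularFunctions c).algebraMap_mem _
    · simpa [framedTriple_zero_apply (hy _)] using hc 0 a (0, b)
    · simpa [framedTriple_one_apply (hy _)] using hc 1 a (0, b)
    · simpa [framedTriple_zero_mul_self_apply (hy _)] using ((hc 0).mul (hc 0)) a (0, b)
  have hblock (i : Fin 3) : IsRegularFamily c fun x => blockTriple (y x) i := by
    simpa only [inv_mul_framedTriple_mul (hy _)] using
      (hframe.inv hy).mul ((hc i).mul hframe)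
  obtain ⟨a, t, b⟩ | ⟨t, a, b⟩ := j
  · exact hframe a (t.succ, b)
  · fin_cases t
    · exact hblock 1 (3, a) (1, b)
    · exact hblock 1 (3, a) (2, b)
    · exact hblock 2 (1, a) (0, b)
    · exact hblock 2 (2, a) (0, b)
    · exact hblock 2 (3, a) (0, b)

theorem exists_frame_eq_one : ∃ y : TripleParam s → k, frame y = 1 := by
  refine ⟨Sum.elim (fun q => (1 : Matrix _ _ k) q.1 (q.2.1.succ, q.2.2)) 0, ?_⟩
  ext i ⟨t, b⟩
  refine Fin.cases ?_ (fun t => ?_) t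
  · simp [Matrix.one_apply]
  · simp

end Parametrization

/-- For every integer `s ≥ 1` and `n = 4s`, `dim C₃(N_n) ≥ n² + s² = 17s²`. -/
theorem dim_nilCommTriples_ge (k : Type*) [Field k] [IsAlgClosed k]
    (s : ℕ) (hs : 1 ≤ s) :
    letI := matTupleZariski k (4 * s) 3
    (((4 * s) ^ 2 + s ^ 2 : ℕ) : WithBot ℕ∞)
        ≤ topologicalKrullDim (nilCommTuples k (4 * s) 3) ∧
      (4 * s) ^ 2 + s ^ 2 = 17 * s ^ 2 := by
  let := matTupleZariski k (4 * s) 3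
  refine ⟨?_, by ring⟩
  have := IsAlgClosed.instInfinite (K := k)
  let D := {y : TripleParam s → k // eval y (frameDet k s) ≠ 0}
  have hD (y : D) : (frame y.1).det ≠ 0 := eval_frameDet y.1 ▸ y.2
  let e : Fin 4 × Fin s ≃ Fin (4 * s) := finProdFinEquiv
  let Φ := Matrix.reindexAlgEquiv k k e
  let f : D → nilCommTuples k (4 * s) 3 := fun y =>
    ⟨fun i => Φ (framedTriple y.1 i),
      fun i => ⟨3, by rw [← map_pow, framedTriple_pow_three (hD y), map_zero]⟩,
      fun i j => by rw [← map_mul, framedTriple_commute (hD y), map_mul]⟩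
  let c : (Fin 3 → Matrix (Fin (4 * s)) (Fin (4 * s)) k) →
    Fin 3 × Fin (4 * s) × Fin (4 * s) → k := fun x q => x q.1 q.2.1 q.2.2
  let c' := (c ∘ Subtype.val) ∘ f
  have hle : zariskiOf (fun y : D => y.1) ≤ zariskiOf c' := zariskiOf_le_of_regular fun q =>
    isRegularFamily_framedTriple hD q.1 (e.symm q.2.1) (e.symm q.2.2)
  have hge : zariskiOf c' ≤ zariskiOf (fun y : D => y.1) := by
    refine zariskiOf_le_of_regular fun j =>
      param_mem_regularFunctions hD (fun i a b => ?_) j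
    simpa [c', c, f, Φ] using coord_mem_regularFunctions c' (i, e a, e b)
  let : TopologicalSpace D := zariskiOf fun y => y.1
  have hf : Topology.IsInducing f := by
    refine ⟨(le_antisymm hle hge).trans ?_⟩
    rw [← induced_zariskiOf f, ← induced_zariskiOf Subtype.val]
    rfl
  obtain ⟨y₀, hy₀⟩ := exists_frame_eq_one (s := s) (k := k)
  have hdim := card_le_topologicalKrullDim (frameDet k s) y₀ (by simp [eval_frameDet, hy₀])
  have hcard : Fintype.card (TripleParam s) = (4 * s) ^ 2 + s ^ 2 := by
    simp only [Fintype.card_sum, Fintype.card_prod, Fintype.card_fin]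
    ring
  rw [← hcard]
  exact hdim.trans hf.topologicalKrullDim_le
end
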